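/- Let ν > 1/2 be real. Let X be a random variable on a probability space (Ω,𝔽,ℙ) and Y a random variable on a probability space (Ω',𝔽',ℙ'), both nonnegative almost surely, and suppose that 𝔼[F_ν(−t·X)] = 𝔼[F_ν(−t·Y)] for every real t ≥ 0. Then X and Y have the same distribution, i.e. the pushforward measure of ℙ under X equals the pushforward measure of ℙ' under Y. -/

import Mathlib

open MeasureTheory ProbabilityTheory Filter Topology

/-- The function `F_ν(x) = ∑_{k=0}^∞ x^k/(k!·(ν)_k)`, where `(ν)_k` is the Pochhammer
symbol. -/
noncomputable def Fnu (ν : ℝ) (x : ℝ) : ℝ :=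
  ∑' k : ℕ, x ^ k / (k.factorial * (ascPochhammer ℝ k).eval ν)

lemma ascPochhammer_eval_succ_left (ν : ℝ) (k : ℕ) :
    (ascPochhammer ℝ (k + 1)).eval ν = ν * (ascPochhammer ℝ k).eval (ν + 1) := by
  simp [ascPochhammer_succ_left]

lemma half_le_ascPochhammer_eval {ν : ℝ} (hν : 1 / 2 < ν) (k : ℕ) :
    1 / 2 ≤ (ascPochhammer ℝ k).eval ν := by
  rcases k with _ | k
  · norm_num
  have h : 1 ≤ (ascPochhammer ℝ k).eval (ν + 1) := by
    induction k with
    | zero => simp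
    | succ k ih =>
      rw [ascPochhammer_succ_eval]
      have hk : (0 : ℝ) ≤ k := k.cast_nonneg
      nlinarith
  rw [ascPochhammer_eval_succ_left]
  nlinarith

lemma Gamma_add_nat_eq_ascPochhammer {ν : ℝ} (hν : 0 < ν) (k : ℕ) :
    Real.Gamma (ν + k) = (ascPochhammer ℝ k).eval ν * Real.Gamma ν := by
  induction k with
  | zero => simp
  | succ k ih =>
    rw [ascPochhammer_succ_eval, Nat.cast_succ, ← add_assoc,
      Real.Gamma_add_one (by positivity), ih]
    ring

lemma summable_Fnu {ν : ℝ} (hν : 1 / 2 < ν) (x : ℝ) :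
    Summable fun k : ℕ ↦ x ^ k / (k.factorial * (ascPochhammer ℝ k).eval ν) := by
  refine .of_norm_bounded ((Real.summable_pow_div_factorial |x|).mul_left 2) fun k ↦ ?_
  have h := half_le_ascPochhammer_eval hν k
  have hf : (0 : ℝ) < k.factorial := by positivity
  have hd : 0 < k.factorial * (ascPochhammer ℝ k).eval ν := by positivity
  rw [Real.norm_eq_abs, abs_div, abs_pow, abs_of_pos hd, ← mul_div_assoc,
    div_le_div_iff₀ hd hf]
  have := mul_nonneg (mul_nonneg (pow_nonneg (abs_nonneg x) k) hf.le)
    (by linarith : 0 ≤ 2 * (ascPochhammer ℝ k).eval ν - 1)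
  linarith

lemma hasDerivAt_Fnu {ν : ℝ} (hν : 1 / 2 < ν) (x : ℝ) :
    HasDerivAt (Fnu ν) (Fnu (ν + 1) x / ν) x := by
  have hν0 : 0 < ν := by linarith
  have hu : Summable fun n : ℕ ↦ 2 * ((n : ℝ) * (|x| + 1) ^ (n - 1) / n.factorial) := by
    refine Summable.mul_left 2 ((summable_nat_add_iff
      (f := fun n : ℕ ↦ (n : ℝ) * (|x| + 1) ^ (n - 1) / n.factorial) 1).1 ?_)
    refine (Real.summable_pow_div_factorial (|x| + 1)).congr fun n ↦ ?_
    rw [Nat.factorial_succ]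
    push_cast
    field_simp
  have hg' (n : ℕ) (y : ℝ) (hy : y ∈ Metric.ball (0 : ℝ) (|x| + 1)) :
      ‖(n : ℝ) * y ^ (n - 1) / (n.factorial * (ascPochhammer ℝ n).eval ν)‖ ≤
        2 * ((n : ℝ) * (|x| + 1) ^ (n - 1) / n.factorial) := by
    have h := half_le_ascPochhammer_eval hν n
    have hf : (0 : ℝ) < n.factorial := by positivity
    have hy' : |y| ≤ |x| + 1 := by simpa using (mem_ball_zero_iff.1 hy).le
    have hpow : (n : ℝ) * |y| ^ (n - 1) ≤ n * (|x| + 1) ^ (n - 1) := by gcongr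
    rw [Real.norm_eq_abs, abs_div, abs_mul, Nat.abs_cast, abs_pow, abs_of_pos (a := _ * _)
      (by positivity)]
    calc _ ≤ (n : ℝ) * (|x| + 1) ^ (n - 1) / (n.factorial * (1 / 2)) := by gcongr
      _ = _ := by field_simp
  have hx : x ∈ Metric.ball (0 : ℝ) (|x| + 1) := by simp
  have h := hasDerivAt_tsum_of_isPreconnected
    (g := fun (n : ℕ) (y : ℝ) ↦ y ^ n / (n.factorial * (ascPochhammer ℝ n).eval ν))
    hu Metric.isOpen_ball (convex_ball (0 : ℝ) (|x| + 1)).isPreconnected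
    (fun n y _ ↦ (hasDerivAt_pow n y).div_const _) hg' hx (summable_Fnu hν x) hx
  convert! h using 1
  rw [(Summable.of_norm_bounded hu fun n ↦ hg' n x hx).tsum_eq_zero_add]
  simp only [Nat.cast_zero, zero_mul, zero_div, zero_add, Fnu]
  rw [← tsum_div_const]
  refine tsum_congr fun n ↦ ?_
  have := half_le_ascPochhammer_eval (by linarith : 1 / 2 < ν + 1) n
  rw [ascPochhammer_eval_succ_left, Nat.factorial_succ]
  push_cast
  field_simp

lemma continuous_Fnu {ν : ℝ} (hν : 1 / 2 < ν) : Continuous (Fnu ν) :=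
  continuous_iff_continuousAt.2 fun x ↦ (hasDerivAt_Fnu hν x).continuousAt

@[simp]
lemma Fnu_zero (ν : ℝ) : Fnu ν 0 = 1 := by
  rw [Fnu, tsum_eq_single 0 fun k hk ↦ by simp [hk]]
  simp

/-- The contiguous relation for three consecutive parameters, equivalent to the differential
equation satisfied by `Fnu ν`. -/
lemma Fnu_contiguous {ν : ℝ} (hν : 1 / 2 < ν) (x : ℝ) :
    x * (Fnu (ν + 1 + 1) x / (ν + 1)) / ν + Fnu (ν + 1) x = Fnu ν x := by
  have hν0 : 0 < ν := by linarith
  have h1 : 1 / 2 < ν + 1 := by linarith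
  have h2 : 1 / 2 < ν + 1 + 1 := by linarith
  simp only [Fnu]
  rw [(summable_Fnu hν x).tsum_eq_zero_add, (summable_Fnu h1 x).tsum_eq_zero_add,
    ← tsum_div_const, ← tsum_mul_left, ← tsum_div_const]
  simp only [pow_zero, Nat.factorial_zero, Nat.cast_one, ascPochhammer_zero, Polynomial.eval_one,
    mul_one, div_one]
  rw [add_left_comm, ← Summable.tsum_add]
  · congr 1
    refine tsum_congr fun n ↦ ?_
    have p1 := half_le_ascPochhammer_eval h1 n
    have p2 := half_le_ascPochhammer_eval h2 n
    have key : (ν + 1) * (ascPochhammer ℝ n).eval (ν + 1 + 1) =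
        (ascPochhammer ℝ n).eval (ν + 1) * (ν + 1 + n) := by
      rw [← ascPochhammer_eval_succ_left, ascPochhammer_succ_eval]
    rw [ascPochhammer_eval_succ_left, ascPochhammer_eval_succ_left, Nat.factorial_succ, key]
    have e : x * (x ^ n / (n.factorial * (ascPochhammer ℝ n).eval (ν + 1 + 1)) / (ν + 1)) / ν =
        x ^ (n + 1) / (n.factorial * ν * ((ν + 1) * (ascPochhammer ℝ n).eval (ν + 1 + 1))) := by
      rw [pow_succ']
      field_simp
    rw [e, key]
    push_cast
    field_simp
    ring
  · exact (((summable_Fnu h2 x).div_const _).mul_left x).div_const _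
  · exact (summable_nat_add_iff 1).2 (summable_Fnu h1 x)

/-- `Fnu ν` is bounded by `1` on the negative half-line, because its energy is nonincreasing. -/
lemma abs_Fnu_neg_le_one {ν : ℝ} (hν : 1 / 2 < ν) {x : ℝ} (hx : 0 ≤ x) : |Fnu ν (-x)| ≤ 1 := by
  have hν0 : 0 < ν := by linarith
  have h1 : 1 / 2 < ν + 1 := by linarith
  let E : ℝ → ℝ := fun x ↦ Fnu ν (-x) ^ 2 + x * (Fnu (ν + 1) (-x) / ν) ^ 2
  have hE (y : ℝ) : HasDerivAt E ((1 - 2 * ν) * (Fnu (ν + 1) (-y) / ν) ^ 2) y := by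
    have d0 : HasDerivAt (fun y ↦ Fnu ν (-y)) (Fnu (ν + 1) (-y) / ν * (-1)) y :=
      (hasDerivAt_Fnu hν (-y)).comp y (hasDerivAt_neg y)
    have d1 : HasDerivAt (fun y ↦ Fnu (ν + 1) (-y)) (Fnu (ν + 1 + 1) (-y) / (ν + 1) * (-1)) y :=
      (hasDerivAt_Fnu h1 (-y)).comp y (hasDerivAt_neg y)
    have d := (d0.pow 2).add ((hasDerivAt_id y).mul ((d1.div_const ν).pow 2))
    refine d.congr_deriv ?_
    rw [← Fnu_contiguous hν (-y)]
    simp only [id, Pi.pow_apply]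
    push_cast
    field_simp
    ring
  have hanti : Antitone E := antitone_of_deriv_nonpos (fun y ↦ (hE y).differentiableAt) fun y ↦ by
    rw [(hE y).deriv]
    exact mul_nonpos_of_nonpos_of_nonneg (by linarith) (sq_nonneg _)
  have h := hanti hx
  simp only [E, neg_zero, Fnu_zero, one_pow, zero_mul, add_zero] at h
  rw [← sq_le_one_iff_abs_le_one]
  have := mul_nonneg hx (sq_nonneg (Fnu (ν + 1) (-x) / ν))
  linarith

lemma integrable_rpow_mul_exp_neg_mul_Ioi {a r : ℝ} (ha : 0 < a) (hr : 0 < r) :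
    Integrable (fun t : ℝ ↦ t ^ (a - 1) * Real.exp (-(r * t))) (volume.restrict (Set.Ioi 0)) := by
  refine not_imp_comm.1 integral_undef ?_
  rw [Real.integral_rpow_mul_exp_neg_mul_Ioi ha hr]
  have := Real.Gamma_pos_of_pos ha
  positivity

/-- The Laplace transform of `t ↦ t ^ (ν - 1) F_ν(-t x)`. -/
lemma integral_Fnu_mul_rpow_mul_exp {ν : ℝ} (hν : 1 / 2 < ν) (x : ℝ) {r : ℝ} (hr : 0 < r) :
    ∫ t in Set.Ioi 0, Fnu ν (-t * x) * (t ^ (ν - 1) * Real.exp (-(r * t))) =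
      (1 / r) ^ ν * Real.Gamma ν * Real.exp (-(x / r)) := by
  have hν0 : 0 < ν := by linarith
  have hterm (k : ℕ) (t : ℝ) (ht : t ∈ Set.Ioi (0 : ℝ)) :
      (-t * x) ^ k / (k.factorial * (ascPochhammer ℝ k).eval ν) *
        (t ^ (ν - 1) * Real.exp (-(r * t))) =
      (-x) ^ k / (k.factorial * (ascPochhammer ℝ k).eval ν) *
        (t ^ (ν + k - 1) * Real.exp (-(r * t))) := by
    rw [show ν + k - 1 = ν - 1 + k by ring, Real.rpow_add_natCast (ne_of_gt ht),
      show -t * x = -x * t by ring, mul_pow]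
    ring
  have hcoef (k : ℕ) (y : ℝ) : y ^ k / (k.factorial * (ascPochhammer ℝ k).eval ν) *
      ((1 / r) ^ (ν + k) * Real.Gamma (ν + k)) =
        (1 / r) ^ ν * Real.Gamma ν * ((y / r) ^ k / k.factorial) := by
    have h := half_le_ascPochhammer_eval hν k
    rw [Gamma_add_nat_eq_ascPochhammer hν0, Real.rpow_add_natCast (by positivity), div_pow y,
      div_pow 1 r k]
    field_simp
    simp
  have hint (k : ℕ) : ∫ t in Set.Ioi 0, (-t * x) ^ k /
      (k.factorial * (ascPochhammer ℝ k).eval ν) * (t ^ (ν - 1) * Real.exp (-(r * t))) =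
        (1 / r) ^ ν * Real.Gamma ν * ((-x / r) ^ k / k.factorial) := by
    rw [setIntegral_congr_fun measurableSet_Ioi (hterm k), integral_const_mul,
      Real.integral_rpow_mul_exp_neg_mul_Ioi (by positivity) hr, hcoef]
  have hnorm (k : ℕ) : ∫ t in Set.Ioi 0, ‖(-t * x) ^ k /
      (k.factorial * (ascPochhammer ℝ k).eval ν) * (t ^ (ν - 1) * Real.exp (-(r * t)))‖ =
        (1 / r) ^ ν * Real.Gamma ν * ((|x| / r) ^ k / k.factorial) := by
    have hp := half_le_ascPochhammer_eval hν k
    rw [← hcoef, ← Real.integral_rpow_mul_exp_neg_mul_Ioi (by positivity) hr,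
      ← integral_const_mul]
    refine setIntegral_congr_fun measurableSet_Ioi fun t ht ↦ ?_
    have ht0 : 0 < t := ht
    rw [hterm k t ht, norm_mul, Real.norm_eq_abs, Real.norm_eq_abs, abs_div, abs_pow, abs_neg,
      abs_of_pos (a := _ * Polynomial.eval _ _) (by positivity),
      abs_of_pos (a := _ * Real.exp _) (by positivity)]
  have hs := hasSum_integral_of_summable_integral_norm
    (μ := volume.restrict (Set.Ioi (0 : ℝ)))
    (F := fun (k : ℕ) (t : ℝ) ↦ (-t * x) ^ k / (k.factorial * (ascPochhammer ℝ k).eval ν) *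
      (t ^ (ν - 1) * Real.exp (-(r * t)))) ?_ ?_
  · simp only [hint] at hs
    have he : HasSum (fun k : ℕ ↦ (-x / r) ^ k / k.factorial) (Real.exp (-x / r)) := by
      rw [Real.exp_eq_exp_ℝ]
      exact NormedSpace.expSeries_div_hasSum_exp (-x / r)
    simp only [tsum_mul_right] at hs
    rw [← neg_div]
    exact hs.unique (he.mul_left _)
  · intro k
    refine ((integrable_rpow_mul_exp_neg_mul_Ioi (a := ν + k) (by positivity) hr).const_mul
      ((-x) ^ k / (k.factorial * (ascPochhammer ℝ k).eval ν))).congr ?_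
    filter_upwards [ae_restrict_mem measurableSet_Ioi] with t ht
    exact (hterm k t ht).symm
  · simp only [hnorm]
    exact (Real.summable_pow_div_factorial _).mul_left _

section Law

variable {Ω : Type*} [MeasurableSpace Ω] {Ω' : Type*} [MeasurableSpace Ω']
  {P : Measure Ω} {P' : Measure Ω'} [IsProbabilityMeasure P] [IsProbabilityMeasure P']

lemma integral_integral_Fnu_mul_rpow_mul_exp {ν : ℝ} (hν : 1 / 2 < ν) {X : Ω → ℝ}
    (hX : Measurable X)
    (hX0 : ∀ᵐ ω ∂P, 0 ≤ X ω) {r : ℝ} (hr : 0 < r) :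
    ∫ t in Set.Ioi 0, (∫ ω, Fnu ν (-t * X ω) ∂P) * (t ^ (ν - 1) * Real.exp (-(r * t))) =
      (1 / r) ^ ν * Real.Gamma ν * ∫ ω, Real.exp (-(X ω / r)) ∂P := by
  rw [← integral_const_mul]
  simp only [← integral_Fnu_mul_rpow_mul_exp hν _ hr, ← integral_mul_const]
  refine integral_integral_swap ?_
  have hI := (integrable_rpow_mul_exp_neg_mul_Ioi (by linarith : 0 < ν) hr).comp_fst P
  refine hI.mono ?_ ?_
  · refine AEStronglyMeasurable.mul ?_ hI.aestronglyMeasurable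
    exact ((continuous_Fnu hν).measurable.comp
      (measurable_fst.neg.mul (hX.comp measurable_snd))).aestronglyMeasurable
  · have h1 := Measure.quasiMeasurePreserving_fst (μ := volume.restrict (Set.Ioi (0 : ℝ)))
      (ν := P) |>.ae (ae_restrict_mem measurableSet_Ioi)
    have h2 := Measure.quasiMeasurePreserving_snd (μ := volume.restrict (Set.Ioi (0 : ℝ)))
      (ν := P) |>.ae hX0
    filter_upwards [h1, h2] with p hp1 hp2
    have hb := abs_Fnu_neg_le_one hν (mul_nonneg (le_of_lt hp1) hp2)
    simp only [Function.uncurry, norm_mul (Fnu _ _)]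
    rw [neg_mul, Real.norm_eq_abs (Fnu _ _)]
    exact mul_le_of_le_one_left (norm_nonneg _) hb

lemma hasSum_complexMGF_of_abs_le_one {U : Ω → ℝ} (hU : Measurable U)
    (h : ∀ᵐ ω ∂P, |U ω| ≤ 1) (z : ℂ) :
    HasSum (fun n : ℕ ↦ z ^ n / n.factorial * ((∫ ω, U ω ^ n ∂P : ℝ) : ℂ)) (complexMGF U P z) := by
  have hb (n : ℕ) : ∀ᵐ ω ∂P, ‖z ^ n / n.factorial * ((U ω ^ n : ℝ) : ℂ)‖ ≤
      ‖z‖ ^ n / n.factorial := by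
    filter_upwards [h] with ω hω
    rw [norm_mul, norm_div, norm_pow, Complex.norm_natCast, Complex.norm_real, norm_pow]
    exact mul_le_of_le_one_right (by positivity) (pow_le_one₀ (norm_nonneg _) hω)
  have hi (n : ℕ) : Integrable (fun ω ↦ z ^ n / n.factorial * ((U ω ^ n : ℝ) : ℂ)) P := by
    refine .of_bound (by fun_prop) _ (hb n)
  have hs := hasSum_integral_of_summable_integral_norm hi ?_
  · convert! hs using 1
    · ext n
      rw [integral_const_mul, integral_complex_ofReal]
    · refine integral_congr_ae (.of_forall fun ω ↦ ?_)
      simp only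
      rw [Complex.exp_eq_exp_ℂ, NormedSpace.exp_eq_tsum_div]
      refine tsum_congr fun n ↦ ?_
      push_cast
      ring
  · refine .of_nonneg_of_le (fun n ↦ by positivity) (fun n ↦ ?_)
      (Real.summable_pow_div_factorial ‖z‖)
    calc _ ≤ ∫ _, ‖z‖ ^ n / n.factorial ∂P :=
          integral_mono_ae (hi n).norm (integrable_const _) (hb n)
      _ = _ := by simp

/-- Laws of random variables in `[-1, 1]` are determined by their moments. -/
lemma map_eq_of_moments_eq {U : Ω → ℝ} {V : Ω' → ℝ} (hU : Measurable U) (hV : Measurable V)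
    (hU1 : ∀ᵐ ω ∂P, |U ω| ≤ 1) (hV1 : ∀ᵐ ω ∂P', |V ω| ≤ 1)
    (h : ∀ n : ℕ, ∫ ω, U ω ^ n ∂P = ∫ ω, V ω ^ n ∂P') : P.map U = P'.map V := by
  refine Measure.ext_of_complexMGF_eq hU.aemeasurable hV.aemeasurable ?_
  ext z
  refine (hasSum_complexMGF_of_abs_le_one hU hU1 z).unique ?_
  simp only [h]
  exact hasSum_complexMGF_of_abs_le_one hV hV1 z

lemma map_eq_of_laplace_eq {X : Ω → ℝ} {Y : Ω' → ℝ} (hX : Measurable X) (hY : Measurable Y)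
    (hX0 : ∀ᵐ ω ∂P, 0 ≤ X ω) (hY0 : ∀ᵐ ω ∂P', 0 ≤ Y ω)
    (h : ∀ r : ℝ, 0 < r → ∫ ω, Real.exp (-(X ω / r)) ∂P = ∫ ω, Real.exp (-(Y ω / r)) ∂P') :
    P.map X = P'.map Y := by
  have hexp : Measurable fun x : ℝ ↦ Real.exp (-x) := by fun_prop
  have hlog : Measurable fun x : ℝ ↦ -Real.log x := by fun_prop
  have key : P.map (fun ω ↦ Real.exp (-X ω)) = P'.map (fun ω ↦ Real.exp (-Y ω)) := by
    refine map_eq_of_moments_eq (hexp.comp hX) (hexp.comp hY) ?_ ?_ fun n ↦ ?_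
    · filter_upwards [hX0] with ω hω
      simpa using hω
    · filter_upwards [hY0] with ω hω
      simpa using hω
    · rcases n.eq_zero_or_pos with rfl | hn
      · simp
      · convert h (1 / n) (by positivity) using 4 <;>
        · rw [← Real.exp_nat_mul]
          congr 1
          simp
          ring
  have := congrArg (Measure.map fun x : ℝ ↦ -Real.log x) key
  rw [Measure.map_map hlog (by fun_prop), Measure.map_map hlog (by fun_prop)] at this
  simpa [Function.comp_def] using this

end Law

/-- Lemma 4.17 of the paper: the Hankel transform of a nonnegative random variable
determines its distribution. -/
theorem Fnu_transform_determines_law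
    {Ω : Type*} [MeasurableSpace Ω] {Ω' : Type*} [MeasurableSpace Ω']
    (P : Measure Ω) (P' : Measure Ω') [IsProbabilityMeasure P] [IsProbabilityMeasure P']
    (ν : ℝ) (hν : 1 / 2 < ν) (X : Ω → ℝ) (Y : Ω' → ℝ)
    (hX : Measurable X) (hY : Measurable Y)
    (hXpos : ∀ᵐ ω ∂P, 0 ≤ X ω) (hYpos : ∀ᵐ ω ∂P', 0 ≤ Y ω)
    (heq : ∀ t : ℝ, 0 ≤ t →
      ∫ ω, Fnu ν (-t * X ω) ∂P = ∫ ω, Fnu ν (-t * Y ω) ∂P') :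
    Measure.map X P = Measure.map Y P' := by
  refine map_eq_of_laplace_eq hX hY hXpos hYpos fun r hr ↦ ?_
  have hΓ := Real.Gamma_pos_of_pos (by linarith : 0 < ν)
  have hc : (1 / r) ^ ν * Real.Gamma ν ≠ 0 := by positivity
  refine mul_left_cancel₀ hc ?_
  rw [← integral_integral_Fnu_mul_rpow_mul_exp hν hX hXpos hr,
    ← integral_integral_Fnu_mul_rpow_mul_exp hν hY hYpos hr]
  refine setIntegral_congr_fun measurableSet_Ioi fun t ht ↦ ?_
  simp only [heq t (le_of_lt ht)]
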